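/- Let f be a homogeneous real polynomial (form) of even degree d ≥ 2 in x_1,…,x_n that is positive definite (f(x) > 0 for all x ∈ ℝⁿ with x ≠ 0), admitting a csp (x(1),…,x(p)) satisfying the RIP. Then for every ε > 0 there exist, for each ℓ ∈ {1,…,p}, a sum of squares σ_ℓ ∈ Σ[x(ℓ) ∪ {w_ℓ}] and a polynomial τ_ℓ ∈ ℝ[x(ℓ) ∪ {w_ℓ}] such that f + ε·Σ_{ℓ=1}^p w_ℓ^d = Σ_{ℓ=1}^p ( σ_ℓ + τ_ℓ·(Σ_{x_i∈x(ℓ)} x_i² + w_ℓ² − 1) ) as polynomials in x_1,…,x_n,w_1,…,w_p. -/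

import Mathlib

open MvPolynomial

/-- `q` is a sum of squares of polynomials using only the variables in `A`. -/
def IsSOSOn {σ : Type*} [DecidableEq σ] (A : Finset σ) (q : MvPolynomial σ ℝ) : Prop :=
  ∃ (t : ℕ) (h : Fin t → MvPolynomial σ ℝ),
    (∀ i, (h i).vars ⊆ A) ∧ q = ∑ i, (h i) ^ 2

/-- The weight that turns the monomial `u ^ a` into its expansion in the Bernstein basis of
degree `N`, at node `t = k / N` and step `h = 1 / N`. It tends to `t ^ a` as `h` tends to `0`. -/
noncomputable def bernsteinWeight (a : ℕ) (t h : ℝ) : ℝ :=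
  ∏ j ∈ Finset.range a, (t - j * h) / (1 - j * h)

lemma bernsteinWeight_zero_right (a : ℕ) (t : ℝ) : bernsteinWeight a t 0 = t ^ a := by
  simp [bernsteinWeight]

lemma continuousAt_bernsteinWeight (a : ℕ) (t : ℝ) :
    ContinuousAt (fun z : ℝ × ℝ => bernsteinWeight a z.2 z.1) (0, t) := by
  unfold bernsteinWeight
  refine tendsto_finsetProd _ fun j _ => ?_
  exact ContinuousAt.div (by fun_prop) (by fun_prop) (by simp)

lemma prod_range_sub_eq_descFactorial (k a : ℕ) :
    ∏ j ∈ Finset.range a, ((k : ℝ) - j) = (k.descFactorial a : ℝ) := by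
  induction a with
  | zero => simp
  | succ a ih =>
    rw [Finset.prod_range_succ, ih, Nat.descFactorial_succ]
    rcases le_or_gt a k with h | h
    · push_cast [Nat.cast_sub h]; ring
    · simp [Nat.descFactorial_of_lt h]

lemma bernsteinWeight_node {N k a : ℕ} (haN : a ≤ N) (hN : 0 < N) :
    bernsteinWeight a (k / N) (1 / N) = (k.descFactorial a : ℝ) / N.descFactorial a := by
  rw [bernsteinWeight, ← prod_range_sub_eq_descFactorial, ← prod_range_sub_eq_descFactorial,
    ← Finset.prod_div_distrib]
  refine Finset.prod_congr rfl fun j hj => ?_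
  have hjN : (j : ℝ) < N := by exact_mod_cast (Finset.mem_range.1 hj).trans_le haN
  have hN' : (0 : ℝ) < N := by exact_mod_cast hN
  have h1 : (N : ℝ) - j ≠ 0 := by linarith
  have h2 : 1 - (j : ℝ) * (1 / N) = (N - j) / N := by field_simp
  have h3 : (k : ℝ) / N - j * (1 / N) = (k - j) / N := by field_simp
  rw [h2, h3]
  field_simp

lemma choose_mul_bernsteinWeight_of_lt {N k a : ℕ} (haN : a ≤ N) (hN : 0 < N) (hk : k < a) :
    (N.choose k : ℝ) * bernsteinWeight a (k / N) (1 / N) = 0 := by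
  rw [bernsteinWeight_node haN hN, Nat.descFactorial_of_lt hk, Nat.cast_zero, zero_div, mul_zero]

lemma choose_mul_bernsteinWeight_add {N a m : ℕ} (haN : a ≤ N) (hN : 0 < N) :
    (N.choose (a + m) : ℝ) * bernsteinWeight a ((a + m : ℕ) / N) (1 / N)
      = (N - a).choose m := by
  have h := Nat.choose_mul (n := N) (k := a + m) (s := a) (Nat.le_add_right _ _)
  rw [Nat.add_sub_cancel_left] at h
  have h' : (N.choose (a + m) : ℝ) * (a + m).choose a = N.choose a * (N - a).choose m := by
    exact_mod_cast h
  have hc : (N.choose a : ℝ) ≠ 0 := by exact_mod_cast (Nat.choose_pos haN).ne'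
  have hf : (a.factorial : ℝ) ≠ 0 := by exact_mod_cast a.factorial_ne_zero
  rw [bernsteinWeight_node haN hN, Nat.descFactorial_eq_factorial_mul_choose,
    Nat.descFactorial_eq_factorial_mul_choose]
  push_cast
  field_simp
  linarith

lemma pow_eq_sum_bernstein {R : Type*} [CommRing R] [Algebra ℝ R] {u v : R} (huv : u + v = 1)
    {N a : ℕ} (haN : a ≤ N) (hN : 0 < N) :
    u ^ a = ∑ k ∈ Finset.range (N + 1),
      algebraMap ℝ R (bernsteinWeight a (k / N) (1 / N)) * (N.choose k * (u ^ k * v ^ (N - k))) := by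
  have key (k : ℕ) : algebraMap ℝ R (bernsteinWeight a (k / N) (1 / N)) *
      (N.choose k * (u ^ k * v ^ (N - k))) =
      algebraMap ℝ R (N.choose k * bernsteinWeight a (k / N) (1 / N)) * (u ^ k * v ^ (N - k)) := by
    rw [map_mul, map_natCast]; ring
  simp_rw [key]
  have hs : N + 1 = a + (N - a + 1) := by omega
  rw [hs, Finset.sum_range_add, Finset.sum_eq_zero, zero_add]
  · simp_rw [choose_mul_bernsteinWeight_add haN hN]
    have h1 : (u + v) ^ (N - a) = 1 := by rw [huv, one_pow]
    rw [add_pow] at h1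
    calc u ^ a = u ^ a * 1 := by ring
      _ = _ := by
        rw [← h1, Finset.mul_sum]
        refine Finset.sum_congr rfl fun m hm => ?_
        rw [map_natCast, pow_add, Nat.sub_sub]
        ring
  · intro k hk
    rw [choose_mul_bernsteinWeight_of_lt haN hN (Finset.mem_range.1 hk), map_zero, zero_mul]

/-- A polynomial which is positive on the unit cube has nonnegative coefficients in the Bernstein
basis of sufficiently large degree. -/
lemma aeval_mem_of_pos_on_unit_cube {ι R : Type*} [Fintype ι] [CommRing R] [Algebra ℝ R]
    (S : Subsemiring R) (hS : ∀ r : ℝ, 0 ≤ r → algebraMap ℝ R r ∈ S) {u v : ι → R}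
    (hu : ∀ i, u i ∈ S) (hv : ∀ i, v i ∈ S) (huv : ∀ i, u i + v i = 1) {q : MvPolynomial ι ℝ}
    (hq : ∀ x : ι → ℝ, (∀ i, x i ∈ Set.Icc (0 : ℝ) 1) → 0 < eval x q) :
    aeval u q ∈ S := by
  classical
  let G (h : ℝ) (t : ι → ℝ) : ℝ :=
    ∑ a ∈ q.support, coeff a q * ∏ i, bernsteinWeight (a i) (t i) h
  have hK : IsCompact (Set.univ.pi fun _ : ι => Set.Icc (0 : ℝ) 1) :=
    isCompact_univ_pi fun _ => isCompact_Icc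
  have hG : ∀ᶠ h in nhds (0 : ℝ), ∀ t ∈ Set.univ.pi fun _ : ι => Set.Icc (0 : ℝ) 1, 0 < G h t := by
    refine hK.eventually_forall_of_forall_eventually fun t ht => ?_
    have hc : ContinuousAt (fun z : ℝ × (ι → ℝ) => G z.1 z.2) (0, t) := by
      refine tendsto_finsetSum _ fun a _ => Filter.Tendsto.mul tendsto_const_nhds
        (tendsto_finsetProd _ fun i _ => ?_)
      have h1 : ContinuousAt (fun z : ℝ × (ι → ℝ) => (z.1, z.2 i)) (0, t) := by fun_prop
      exact ContinuousAt.comp (f := fun z : ℝ × (ι → ℝ) => (z.1, z.2 i))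
        (continuousAt_bernsteinWeight (a i) (t i)) h1
    refine hc.eventually (lt_mem_nhds ?_)
    have := hq t fun i => ht i (Set.mem_univ i)
    rw [eval_eq'] at this
    simpa [G, bernsteinWeight_zero_right] using this
  have hlim : ∀ᶠ N : ℕ in Filter.atTop,
      ∀ t ∈ Set.univ.pi fun _ : ι => Set.Icc (0 : ℝ) 1, 0 < G (1 / N) t :=
    tendsto_one_div_atTop_nhds_zero_nat.eventually hG
  obtain ⟨N, hGN, hdN, hN⟩ := (hlim.and ((Filter.eventually_ge_atTop q.totalDegree).and
    (Filter.eventually_gt_atTop 0))).exists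
  have hexp : aeval u q = ∑ κ ∈ Fintype.piFinset fun _ : ι => Finset.range (N + 1),
      algebraMap ℝ R (G (1 / N) fun i => κ i / N) *
        ∏ i, (N.choose (κ i) * (u i ^ κ i * v i ^ (N - κ i))) := by
    rw [aeval_def, eval₂_eq']
    simp_rw [G, map_sum, Finset.sum_mul]
    rw [Finset.sum_comm]
    refine Finset.sum_congr rfl fun a ha => ?_
    have haN (i : ι) : a i ≤ N := by
      refine le_trans ?_ ((le_totalDegree ha).trans hdN)
      by_cases hi : i ∈ a.support
      · exact Finset.single_le_sum (f := fun i => a i) (fun _ _ => Nat.zero_le _) hi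
      · simp [Finsupp.notMem_support_iff.1 hi]
    rw [Finset.prod_congr rfl fun i _ => pow_eq_sum_bernstein (huv i) (haN i) hN,
      Finset.prod_univ_sum, Finset.mul_sum]
    refine Finset.sum_congr rfl fun κ _ => ?_
    rw [map_mul, map_prod, Finset.prod_mul_distrib, mul_assoc]
  rw [hexp]
  refine Subsemiring.sum_mem _ fun κ hκ => S.mul_mem (hS _ (hGN _ fun i _ => ?_).le)
    (Subsemiring.prod_mem _ fun i _ => S.mul_mem (natCast_mem _ _)
      (S.mul_mem (pow_mem (hu i) _) (pow_mem (hv i) _)))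
  have hκi : κ i ≤ N := Nat.lt_succ_iff.1 (Finset.mem_range.1 (Fintype.mem_piFinset.1 hκ i))
  exact ⟨by positivity, div_le_one_of_le₀ (by exact_mod_cast hκi) (by positivity)⟩

/-- The cube `[-1, 1]^ι`. -/
def symmCube (ι : Type*) : Set (ι → ℝ) := Set.univ.pi fun _ => Set.Icc (-1) 1

lemma mem_symmCube {ι : Type*} {x : ι → ℝ} : x ∈ symmCube ι ↔ ∀ i, x i ∈ Set.Icc (-1 : ℝ) 1 := by
  simp only [symmCube, Set.mem_univ_pi]

lemma isCompact_symmCube (ι : Type*) : IsCompact (symmCube ι) :=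
  isCompact_univ_pi fun _ => isCompact_Icc

lemma C_half_mul_two {ι : Type*} : (C (1 / 2) * 2 : MvPolynomial ι ℝ) = 1 := by
  rw [← map_ofNat C 2, ← C_mul]; norm_num

lemma mem_of_pos_on_symmCube {ι : Type*} [Fintype ι] (S : Subsemiring (MvPolynomial ι ℝ))
    (hS : ∀ r : ℝ, 0 ≤ r → C r ∈ S) (hu : ∀ i, 1 + X i ∈ S) (hv : ∀ i, 1 - X i ∈ S)
    {q : MvPolynomial ι ℝ} (hq : ∀ x ∈ symmCube ι, 0 < eval x q) : q ∈ S := by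
  let q' : MvPolynomial ι ℝ := aeval (fun i => 2 * X i - 1) q
  have hq' : aeval (fun i => C (1 / 2) * (1 + X i)) q' = q := by
    simp only [q', aeval_eq_bind₁, bind₁_bind₁]
    conv_rhs => rw [← aeval_X_left_apply q, aeval_eq_bind₁]
    congr 2
    funext i
    simp only [map_sub, map_mul, map_ofNat, bind₁_X_right, map_one]
    linear_combination (1 + X i) * C_half_mul_two (ι := ι)
  rw [← hq']
  refine aeval_mem_of_pos_on_unit_cube S (v := fun i => C (1 / 2) * (1 - X i)) hS
    (fun i => S.mul_mem (hS _ (by norm_num)) (hu i))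
    (fun i => S.mul_mem (hS _ (by norm_num)) (hv i)) (fun i => ?_) fun x hx => ?_
  · rw [← mul_add]
    linear_combination C_half_mul_two (ι := ι)
  · have : eval x q' = eval (fun i => 2 * x i - 1) q := by
      simp only [q', aeval_eq_bind₁]
      rw [eval, eval₂Hom_bind₁]
      refine eval₂Hom_congr rfl (funext fun i => ?_) rfl
      simp
    rw [this]
    refine hq _ (mem_symmCube.2 fun i => ?_)
    have := hx i
    constructor <;> linarith [this.1, this.2]

lemma eval_congr_of_vars_subset {ι : Type*} {J : Finset ι} {q : MvPolynomial ι ℝ}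
    (hq : q.vars ⊆ J) {x y : ι → ℝ} (hxy : ∀ i ∈ J, x i = y i) : eval x q = eval y q :=
  eval₂Hom_congr' rfl (fun i hi _ => hxy i (hq hi)) rfl

lemma vars_subset_iff_mem_supported {ι : Type*} {A : Finset ι} {q : MvPolynomial ι ℝ} :
    q.vars ⊆ A ↔ q ∈ supported ℝ (A : Set ι) := by
  rw [mem_supported, Finset.coe_subset]

lemma exists_pos_add_mul_of_isCompact {X : Type*} [TopologicalSpace X] {K : Set X}
    (hK : IsCompact K) {f g : X → ℝ} (hf : Continuous f) (hg : Continuous g)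
    (hg0 : ∀ x, 0 ≤ g x) (h : ∀ x ∈ K, g x = 0 → 0 < f x) :
    ∃ c : ℝ, ∀ x ∈ K, 0 < f x + c * g x := by
  have hK' : IsCompact (K ∩ {x | f x ≤ 0}) := hK.inter_right (isClosed_le hf continuous_const)
  have hpos : ∀ x ∈ K ∩ {x | f x ≤ 0}, 0 < g x := fun x hx =>
    (hg0 x).lt_of_ne' fun h0 => (h x hx.1 h0).not_ge hx.2
  obtain ⟨c, hc⟩ := hK'.bddAbove_image (f := fun x => -f x / g x)
    (hf.neg.continuousOn.div hg.continuousOn fun x hx => (hpos x hx).ne')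
  refine ⟨max c 0 + 1, fun x hx => ?_⟩
  rcases lt_or_ge 0 (f x) with hfx | hfx
  · have := hg0 x
    positivity
  · have hgx := hpos x ⟨hx, hfx⟩
    have h1 : -f x / g x ≤ c := hc ⟨x, ⟨hx, hfx⟩, rfl⟩
    have h2 : -f x / g x < max c 0 + 1 := by linarith [le_max_left c 0]
    rw [div_lt_iff₀ hgx] at h2
    linarith

/-- Stone-Weierstrass on the cube `[-1, 1]^ι`, keeping track of the variables. -/
lemma exists_vars_subset_near {ι : Type*} [DecidableEq ι] {J : Finset ι} {h : (ι → ℝ) → ℝ}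
    (hh : Continuous h) (hJ : ∀ x y : ι → ℝ, (∀ i ∈ J, x i = y i) → h x = h y) {δ : ℝ}
    (hδ : 0 < δ) :
    ∃ q : MvPolynomial ι ℝ, q.vars ⊆ J ∧ ∀ x ∈ symmCube ι, |eval x q - h x| < δ := by
  have : CompactSpace (symmCube ι) := isCompact_iff_compactSpace.1 (isCompact_symmCube ι)
  let φ : MvPolynomial ι ℝ →ₐ[ℝ] C(symmCube ι, ℝ) :=
    aeval fun i => ⟨fun x => x.1 i, (continuous_apply i).comp continuous_subtype_val⟩
  have hφ (q : MvPolynomial ι ℝ) (x : symmCube ι) : φ q x = eval x.1 q := by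
    induction q using MvPolynomial.induction_on with
    | C a => simp [φ]
    | add p q hp hq => simp [hp, hq]
    | mul_X p i hp => simp [hp, φ]
  have hsep : φ.range.SeparatesPoints := by
    intro x y hxy
    obtain ⟨i, hi⟩ := Function.ne_iff.1 (Subtype.coe_injective.ne hxy)
    exact ⟨φ (X i), ⟨φ (X i), ⟨X i, rfl⟩, rfl⟩, by simpa [hφ] using hi⟩
  obtain ⟨⟨_, Q, rfl⟩, hQ⟩ :=
    ContinuousMap.exists_mem_subalgebra_near_continuous_of_separatesPoints φ.range hsep
      (fun x => h x.1) (by fun_prop) δ hδ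
  refine ⟨bind₁ (fun i => if i ∈ J then X i else 0) Q, fun j hj => ?_, fun x hx => ?_⟩
  · obtain ⟨i, -, hi⟩ := mem_vars_bind₁ _ _ hj
    split_ifs at hi with hiJ
    · rw [vars_X, Finset.mem_singleton] at hi
      rwa [hi]
    · simp at hi
  · let y : ι → ℝ := fun i => if i ∈ J then x i else 0
    have hy : y ∈ symmCube ι := mem_symmCube.2 fun i => by
      by_cases hi : i ∈ J
      · simpa [y, hi] using mem_symmCube.1 hx i
      · simp [y, hi]
    have h1 : eval x (bind₁ (fun i => if i ∈ J then X i else 0) Q) = eval y Q := by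
      rw [eval, eval₂Hom_bind₁]
      refine eval₂Hom_congr rfl (funext fun i => ?_) rfl
      by_cases hi : i ∈ J <;> simp [y, hi]
    have h2 : h x = h y := hJ x y fun i hi => by simp [y, hi]
    have h3 := hQ ⟨y, hy⟩
    rw [h1, h2, ← Real.norm_eq_abs]
    simpa [hφ] using h3

/-- Separation of two polynomials by a polynomial in their common variables. -/
lemma exists_separating_polynomial {ι : Type*} [DecidableEq ι] {U A : Finset ι}
    {P Q : MvPolynomial ι ℝ} (hP : P.vars ⊆ U) (hQ : Q.vars ⊆ A)
    (hpos : ∀ x ∈ symmCube ι, 0 < eval x (P + Q)) :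
    ∃ q : MvPolynomial ι ℝ, q.vars ⊆ A ∩ U ∧ (∀ x ∈ symmCube ι, 0 < eval x (P + q)) ∧
      ∀ x ∈ symmCube ι, 0 < eval x (Q - q) := by
  have hne : (symmCube ι).Nonempty := ⟨0, mem_symmCube.2 fun i => by simp⟩
  let glue (x y : ι → ℝ) : ι → ℝ := fun i => if i ∈ A ∩ U then x i else y i
  have hglue : Continuous fun z : (ι → ℝ) × (ι → ℝ) => glue z.1 z.2 := by
    refine continuous_pi fun i => ?_
    by_cases hi : i ∈ A ∩ U
    · simp only [glue, if_pos hi]; fun_prop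
    · simp only [glue, if_neg hi]; fun_prop
  have hcont : Continuous fun z : (ι → ℝ) × (ι → ℝ) => eval (glue z.1 z.2) Q :=
    (MvPolynomial.continuous_eval Q).comp hglue
  let h (x : ι → ℝ) : ℝ := sInf ((fun y => eval (glue x y) Q) '' symmCube ι)
  have hh : Continuous h :=
    (isCompact_symmCube ι).continuous_sInf (f := fun x y => eval (glue x y) Q) hcont
  have hcx (x : ι → ℝ) : ContinuousOn (fun y => eval (glue x y) Q) (symmCube ι) :=
    (hcont.comp (by fun_prop : Continuous fun y : ι → ℝ => (x, y))).continuousOn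
  have hJ (x y : ι → ℝ) (hxy : ∀ i ∈ A ∩ U, x i = y i) : h x = h y := by
    have : glue x = glue y := by
      funext z i
      by_cases hi : i ∈ A ∩ U
      · simp only [glue, if_pos hi, hxy i hi]
      · simp only [glue, if_neg hi]
    simp only [h, this]
  have hle : ∀ x ∈ symmCube ι, h x ≤ eval x Q := fun x hx => by
    refine csInf_le ((isCompact_symmCube ι).bddBelow_image (hcx x)) ⟨x, hx, ?_⟩
    have : glue x x = x := by funext i; simp [glue]
    simp only [this]
  have hPh : ∀ x ∈ symmCube ι, 0 < eval x P + h x := fun x hx => by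
    obtain ⟨y, hy, hyh⟩ := (isCompact_symmCube ι).exists_sInf_image_eq hne (hcx x)
    let z : ι → ℝ := fun i => if i ∈ U then x i else y i
    have hz : z ∈ symmCube ι := mem_symmCube.2 fun i => by
      by_cases hi : i ∈ U
      · simpa [z, hi] using mem_symmCube.1 hx i
      · simpa [z, hi] using mem_symmCube.1 hy i
    have h1 : eval z P = eval x P := eval_congr_of_vars_subset hP fun i hi => by simp [z, hi]
    have h2 : eval z Q = h x := by
      simp only [h, hyh]
      refine eval_congr_of_vars_subset hQ fun i hi => ?_
      simp [z, glue, hi]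
    have := hpos z hz
    rwa [map_add, h1, h2] at this
  obtain ⟨x₀, hx₀, hmin⟩ := (isCompact_symmCube ι).exists_isMinOn hne
    ((MvPolynomial.continuous_eval P).add hh).continuousOn
  set m := eval x₀ P + h x₀ with hm
  have hm0 : 0 < m := hPh x₀ hx₀
  obtain ⟨q, hqv, hq⟩ := exists_vars_subset_near (J := A ∩ U) (h := fun x => h x - m / 2)
    (by fun_prop) (fun x y hxy => by rw [hJ x y hxy]) (half_pos hm0)
  refine ⟨q, hqv, fun x hx => ?_, fun x hx => ?_⟩
  · have h1 := (abs_lt.1 (hq x hx)).1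
    have h2 : m ≤ eval x P + h x := hmin hx
    rw [map_add]
    linarith
  · have h1 := (abs_lt.1 (hq x hx)).2
    have h2 := hle x hx
    rw [map_sub]
    linarith

/-- A positive sparse sum of polynomials whose cliques satisfy the running intersection property
is a sum of positive polynomials with the same sparsity. -/
lemma exists_pos_sparse_decomposition {ι : Type*} [DecidableEq ι] (A : ℕ → Finset ι) (p : ℕ)
    (hRIP : ∀ k < p, ∃ s ≤ k, A (k + 1) ∩ (Finset.range (k + 1)).biUnion A ⊆ A s)
    (F : ℕ → MvPolynomial ι ℝ) (hF : ∀ k, (F k).vars ⊆ A k)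
    (hpos : ∀ x ∈ symmCube ι, 0 < eval x (∑ k ∈ Finset.range (p + 1), F k)) :
    ∃ G : ℕ → MvPolynomial ι ℝ, (∀ k, (G k).vars ⊆ A k) ∧
      ∑ k ∈ Finset.range (p + 1), G k = ∑ k ∈ Finset.range (p + 1), F k ∧
      ∀ k ≤ p, ∀ x ∈ symmCube ι, 0 < eval x (G k) := by
  induction p generalizing F with
  | zero =>
    refine ⟨F, hF, rfl, fun k hk => ?_⟩
    obtain rfl := Nat.le_zero.1 hk
    simpa using hpos
  | succ p ih =>
    obtain ⟨s, hsp, hs⟩ := hRIP p p.lt_succ_self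
    rw [Finset.sum_range_succ] at hpos
    have hPv : (∑ k ∈ Finset.range (p + 1), F k).vars ⊆ (Finset.range (p + 1)).biUnion A :=
      (vars_sum_subset _ _).trans (Finset.biUnion_mono fun k _ => hF k)
    obtain ⟨q, hqv, hPq, hQq⟩ := exists_separating_polynomial hPv (hF (p + 1)) hpos
    have hs' : s ∈ Finset.range (p + 1) := Finset.mem_range.2 (Nat.lt_succ_of_le hsp)
    have hsum : ∑ k ∈ Finset.range (p + 1), (F k + if k = s then q else 0)
        = ∑ k ∈ Finset.range (p + 1), F k + q := by
      rw [Finset.sum_add_distrib, Finset.sum_ite_eq' _ s, if_pos hs']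
    obtain ⟨G, hGv, hGs, hGpos⟩ := ih (fun k hk => hRIP k (hk.trans p.lt_succ_self))
      (fun k => F k + if k = s then q else 0)
      (fun k => by
        rw [vars_subset_iff_mem_supported]
        refine Subalgebra.add_mem _ (vars_subset_iff_mem_supported.1 (hF k)) ?_
        split_ifs with hk
        · exact vars_subset_iff_mem_supported.1 (hk ▸ hqv.trans hs)
        · exact Subalgebra.zero_mem _)
      (by rwa [hsum])
    refine ⟨Function.update G (p + 1) (F (p + 1) - q), fun k => ?_, ?_, fun k hk => ?_⟩
    · rcases eq_or_ne k (p + 1) with rfl | hk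
      · rw [Function.update_self, vars_subset_iff_mem_supported]
        exact Subalgebra.sub_mem _ (vars_subset_iff_mem_supported.1 (hF _))
          (vars_subset_iff_mem_supported.1 (hqv.trans Finset.inter_subset_left))
      · rw [Function.update_of_ne hk]
        exact hGv k
    · rw [Finset.sum_range_succ, Finset.sum_range_succ _ (p + 1), Function.update_self,
        Finset.sum_congr rfl fun k hk => Function.update_of_ne (Finset.mem_range.1 hk).ne _ _,
        hGs, hsum]
      ring
    · rcases eq_or_ne k (p + 1) with rfl | hk'
      · rwa [Function.update_self]
      · rw [Function.update_of_ne hk']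
        exact hGpos k (Nat.lt_succ_iff.1 (hk.lt_of_ne hk'))

/-- The sums of squares modulo the ideal generated by `c`. -/
def sumSqAddMultiples {R : Type*} [CommRing R] (c : R) : Subsemiring R where
  carrier := {q | ∃ s t : R, IsSumSq s ∧ q = s + t * c}
  zero_mem' := ⟨0, 0, .zero, by ring⟩
  one_mem' := ⟨1, 0, .one, by ring⟩
  add_mem' := by
    rintro _ _ ⟨s, t, hs, rfl⟩ ⟨s', t', hs', rfl⟩
    exact ⟨s + s', t + t', hs.add hs', by ring⟩
  mul_mem' := by
    rintro _ _ ⟨s, t, hs, rfl⟩ ⟨s', t', hs', rfl⟩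
    exact ⟨s * s', s * t' + t * s' + t * t' * c, hs.mul hs', by ring⟩

lemma mem_sumSqAddMultiples_sphere {ι : Type*} [Fintype ι] {q : MvPolynomial ι ℝ}
    (hq : ∀ x ∈ symmCube ι, 0 < eval x q) :
    q ∈ sumSqAddMultiples (∑ i, X i ^ 2 - 1 : MvPolynomial ι ℝ) := by
  classical
  have hC (r : ℝ) (hr : 0 ≤ r) : IsSumSq (C r : MvPolynomial ι ℝ) := by
    rw [← Real.mul_self_sqrt hr, C_mul]
    exact .mul_self _
  have hsos (i : ι) (e : MvPolynomial ι ℝ) :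
      IsSumSq (C (1 / 2) * (e * e + ∑ j ∈ Finset.univ.erase i, X j * X j)) :=
    (hC _ (by norm_num)).mul ((IsSumSq.mul_self e).add (IsSumSq.sum fun j _ => .mul_self _))
  have h2 := C_half_mul_two (ι := ι)
  have hsplit (i : ι) : (∑ j, X j ^ 2 : MvPolynomial ι ℝ)
      = X i * X i + ∑ j ∈ Finset.univ.erase i, X j * X j := by
    rw [Finset.add_sum_erase _ (fun j => (X j * X j : MvPolynomial ι ℝ)) (Finset.mem_univ i)]
    exact Finset.sum_congr rfl fun j _ => sq _
  refine mem_of_pos_on_symmCube (sumSqAddMultiples _) (fun r hr => ⟨C r, 0, hC r hr, by ring⟩) (fun i => ?_)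
    (fun i => ?_) hq
  · refine ⟨_, -C (1 / 2), hsos i (1 + X i), ?_⟩
    rw [hsplit i]
    linear_combination (-(1 + X i)) * h2
  · refine ⟨_, -C (1 / 2), hsos i (1 - X i), ?_⟩
    rw [hsplit i]
    linear_combination (-(1 - X i)) * h2

lemma IsSOSOn.of_rename_isSumSq {ι : Type*} [DecidableEq ι] {A : Finset ι}
    {s : MvPolynomial A ℝ} (hs : IsSumSq s) : IsSOSOn A (rename Subtype.val s) := by
  induction hs with
  | zero => exact ⟨0, Fin.elim0, fun i => i.elim0, by simp⟩
  | sq_add a hs ih =>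
    obtain ⟨t, h, hv, he⟩ := ih
    refine ⟨t + 1, Fin.cons (rename Subtype.val a) h, fun i => ?_, ?_⟩
    · refine Fin.cases ?_ (fun j => ?_) i
      · exact (vars_rename _ _).trans fun j hj => by
          obtain ⟨k, -, rfl⟩ := Finset.mem_image.1 hj
          exact k.2
      · exact hv j
    · rw [Fin.sum_univ_succ, map_add, map_mul, he]
      simp [sq]

/-- A sparse Positivstellensatz on the sphere for polynomials positive on the whole cube. -/
lemma exists_isSOSOn_add_mul_sphere {ι : Type*} [DecidableEq ι] {A : Finset ι}
    {q : MvPolynomial ι ℝ} (hqA : q.vars ⊆ A) (hq : ∀ x ∈ symmCube ι, 0 < eval x q) :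
    ∃ s t : MvPolynomial ι ℝ, IsSOSOn A s ∧ t.vars ⊆ A ∧
      q = s + t * (∑ i ∈ A, X i ^ 2 - 1) := by
  obtain ⟨q', rfl⟩ := exists_rename_eq_of_vars_subset_range q (Subtype.val : A → ι)
    Subtype.val_injective (by simpa using hqA)
  have hq' : ∀ x ∈ symmCube A, 0 < eval x q' := fun x hx => by
    have h1 := hq (fun i => if h : i ∈ A then x ⟨i, h⟩ else 0) (mem_symmCube.2 fun i => by
      by_cases hi : i ∈ A
      · simpa [hi] using mem_symmCube.1 hx ⟨i, hi⟩
      · simp [hi])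
    rw [eval_rename] at h1
    convert h1 using 3
    funext i
    simp
  obtain ⟨s, t, hs, rfl⟩ := mem_sumSqAddMultiples_sphere hq'
  refine ⟨rename Subtype.val s, rename Subtype.val t, .of_rename_isSumSq hs,
    (vars_rename _ _).trans fun j hj => ?_, ?_⟩
  · obtain ⟨k, -, rfl⟩ := Finset.mem_image.1 hj
    exact k.2
  · simp only [map_add, map_mul, map_sub, map_sum, map_pow, rename_X, map_one]
    rw [Finset.sum_coe_sort A fun i => (X i ^ 2 : MvPolynomial ι ℝ)]

/-- Let `f` be a positive definite form of even degree `d ≥ 2` in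
`x_1,…,x_n`, admitting a csp `(x(1),…,x(p))` satisfying the RIP. Then for every
`ε > 0` there exist, for each `ℓ`, an SOS `σ_ℓ ∈ Σ[x(ℓ)∪{w_ℓ}]` and
`τ_ℓ ∈ ℝ[x(ℓ)∪{w_ℓ}]` with
`f + ε·Σ_ℓ w_ℓ^d = Σ_ℓ (σ_ℓ + τ_ℓ·(Σ_{x_i∈x(ℓ)} x_i² + w_ℓ² − 1))`. -/
theorem stmt_8
    (n p : ℕ) (hn : 1 ≤ n) (hp : 1 ≤ p)
    (f : MvPolynomial (Fin n) ℝ)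
    (d : ℕ) (hd2 : 2 ≤ d) (hdeven : Even d)
    (hfhom : f.IsHomogeneous d)
    (hfposdef : ∀ x : Fin n → ℝ, x ≠ 0 → 0 < eval x f)
    -- correlative sparsity pattern satisfying the RIP
    (I : Fin p → Finset (Fin n)) (hI : ∀ i : Fin n, ∃ ℓ : Fin p, i ∈ I ℓ)
    (fdec : Fin p → MvPolynomial (Fin n) ℝ)
    (hfdec : f = ∑ ℓ, fdec ℓ) (hfvars : ∀ ℓ, (fdec ℓ).vars ⊆ I ℓ)
    (hRIP : ∀ (ℓ : Fin p) (h : (ℓ : ℕ) + 1 < p), ∃ s : Fin p, s ≤ ℓ ∧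
      I ⟨(ℓ : ℕ) + 1, h⟩ ∩ (Finset.Iic ℓ).biUnion I ⊆ I s)
    -- variable cliques of the lifted problem
    (A : Fin p → Finset (Fin n ⊕ Fin p))
    (hA : ∀ ℓ, A ℓ = insert (Sum.inr ℓ) ((I ℓ).image Sum.inl))
    (ε : ℝ) (hε : 0 < ε) :
    ∃ (σ τ : Fin p → MvPolynomial (Fin n ⊕ Fin p) ℝ),
      (∀ ℓ, IsSOSOn (A ℓ) (σ ℓ)) ∧
      (∀ ℓ, (τ ℓ).vars ⊆ A ℓ) ∧
      rename Sum.inl f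
        + C ε * (∑ ℓ, (X (Sum.inr ℓ)) ^ d)
      = ∑ ℓ, (σ ℓ + τ ℓ * ((∑ i ∈ I ℓ, (X (Sum.inl i)) ^ 2)
          + (X (Sum.inr ℓ)) ^ 2 - 1)) := by
  obtain ⟨m, rfl⟩ : ∃ m, p = m + 1 := ⟨p - 1, by omega⟩
  let c (ℓ : Fin (m + 1)) : MvPolynomial (Fin n ⊕ Fin (m + 1)) ℝ := ∑ i ∈ A ℓ, X i ^ 2 - 1
  have hc (ℓ : Fin (m + 1)) : (∑ i ∈ I ℓ, X (Sum.inl i) ^ 2) + X (Sum.inr ℓ) ^ 2 - 1 = c ℓ := by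
    simp only [c]
    rw [hA, Finset.sum_insert (by simp), Finset.sum_image (by simp)]
    ring
  have hcv (ℓ : Fin (m + 1)) : (c ℓ) ∈ supported ℝ (A ℓ : Set (Fin n ⊕ Fin (m + 1))) :=
    Subalgebra.sub_mem _ (Subalgebra.sum_mem _ fun i hi =>
      Subalgebra.pow_mem _ (X_mem_supported.2 hi) 2) (Subalgebra.one_mem _)
  have hcx (ℓ : Fin (m + 1)) (x : Fin n ⊕ Fin (m + 1) → ℝ) :
      eval x (c ℓ) = (∑ i ∈ I ℓ, x (Sum.inl i) ^ 2) + x (Sum.inr ℓ) ^ 2 - 1 := by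
    simp [← hc]
  let F := rename Sum.inl f + C ε * (∑ ℓ, (X (Sum.inr ℓ : Fin n ⊕ Fin (m + 1))) ^ d)
  have hFx (x : Fin n ⊕ Fin (m + 1) → ℝ) :
      eval x F = eval (fun i => x (Sum.inl i)) f + ε * ∑ ℓ, x (Sum.inr ℓ) ^ d := by
    simp [F, eval_rename, Function.comp_def]
  have hFpos (x : Fin n ⊕ Fin (m + 1) → ℝ) (hx : ∀ ℓ, eval x (c ℓ) = 0) : 0 < eval x F := by
    rw [hFx]
    have hw : 0 ≤ ∑ ℓ, x (Sum.inr ℓ) ^ d := Finset.sum_nonneg fun ℓ _ => hdeven.pow_nonneg _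
    by_cases h0 : (fun i => x (Sum.inl i)) = 0
    · have hf0 : eval (0 : Fin n → ℝ) f = 0 := by
        have := hfhom.coeff_eq_zero (d := 0) (by simp; omega)
        rwa [eval_zero, constantCoeff_eq]
      have hw1 (ℓ : Fin (m + 1)) : x (Sum.inr ℓ) ^ d = 1 := by
        have h1 := hx ℓ
        have h2 (i : Fin n) : x (Sum.inl i) = 0 := congrFun h0 i
        rw [hcx] at h1
        simp only [h2] at h1
        obtain ⟨e, rfl⟩ := hdeven
        have h3 : x (Sum.inr ℓ) ^ 2 = 1 := by simpa [sub_eq_zero] using h1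
        rw [← two_mul, pow_mul, h3, one_pow]
      rw [h0, hf0]
      simp only [hw1, Finset.sum_const, Finset.card_univ, Fintype.card_fin, nsmul_eq_mul, mul_one]
      positivity
    · have := hfposdef _ h0
      positivity
  obtain ⟨K, hK⟩ := exists_pos_add_mul_of_isCompact (isCompact_symmCube (Fin n ⊕ Fin (m + 1)))
    (MvPolynomial.continuous_eval F) (MvPolynomial.continuous_eval (∑ ℓ, c ℓ ^ 2))
    (fun x => by simpa using Finset.sum_nonneg fun ℓ _ => sq_nonneg (eval x (c ℓ)))
    (fun x _ hx => hFpos x fun ℓ => by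
      rw [map_sum, Finset.sum_eq_zero_iff_of_nonneg
        fun ℓ _ => by rw [map_pow]; exact sq_nonneg _] at hx
      simpa using hx ℓ (Finset.mem_univ ℓ))
  let B (k : ℕ) : Finset (Fin n ⊕ Fin (m + 1)) := if h : k < m + 1 then A ⟨k, h⟩ else ∅
  let H (ℓ : Fin (m + 1)) : MvPolynomial (Fin n ⊕ Fin (m + 1)) ℝ :=
    rename Sum.inl (fdec ℓ) + C ε * X (Sum.inr ℓ) ^ d + C K * c ℓ ^ 2
  let H' (k : ℕ) : MvPolynomial (Fin n ⊕ Fin (m + 1)) ℝ := if h : k < m + 1 then H ⟨k, h⟩ else 0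
  have hHs : ∑ k ∈ Finset.range (m + 1), H' k = F + C K * ∑ ℓ, c ℓ ^ 2 := by
    rw [← Fin.sum_univ_eq_sum_range]
    simp only [H', Fin.is_lt, dif_pos, H, F, hfdec, Finset.sum_add_distrib, Finset.mul_sum, map_sum]
  have hH' (k : ℕ) : (H' k).vars ⊆ B k := by
    by_cases hk : k < m + 1
    · simp only [H', B, dif_pos hk, H]
      have hC (r : ℝ) : (C r : MvPolynomial (Fin n ⊕ Fin (m + 1)) ℝ) ∈
          supported ℝ (A ⟨k, hk⟩ : Set (Fin n ⊕ Fin (m + 1))) := Subalgebra.algebraMap_mem _ r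
      rw [vars_subset_iff_mem_supported]
      refine add_mem (add_mem ?_ (mul_mem (hC _) (pow_mem (X_mem_supported.2 ?_) _)))
        (mul_mem (hC _) (pow_mem (hcv _) _))
      · rw [← vars_subset_iff_mem_supported, hA]
        exact (vars_rename _ _).trans ((Finset.image_subset_image (hfvars _)).trans
          (Finset.subset_insert _ _))
      · simp [hA]
    · simp only [H', dif_neg hk, vars_0, Finset.empty_subset]
  have hRIP' (k : ℕ) (hk : k < m) :
      ∃ s ≤ k, B (k + 1) ∩ (Finset.range (k + 1)).biUnion B ⊆ B s := by
    obtain ⟨s, hs, hsub⟩ := hRIP ⟨k, by omega⟩ (by simpa using hk)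
    refine ⟨s, hs, fun v hv => ?_⟩
    obtain ⟨hv1, hv2⟩ := Finset.mem_inter.1 hv
    obtain ⟨j, hj, hvj⟩ := Finset.mem_biUnion.1 hv2
    have hjk : j < k + 1 := Finset.mem_range.1 hj
    have hj' : j < m + 1 := by omega
    have hk' : k + 1 < m + 1 := by omega
    simp only [B, dif_pos hk', dif_pos hj', dif_pos s.is_lt, hA] at hv1 hvj ⊢
    rcases v with i | w
    · simp only [Finset.mem_insert, reduceCtorEq, Finset.mem_image, Sum.inl.injEq, exists_eq_right,
        false_or] at hv1 hvj ⊢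
      exact hsub (Finset.mem_inter.2 ⟨hv1, Finset.mem_biUnion.2
        ⟨⟨j, hj'⟩, Finset.mem_Iic.2 (Fin.mk_le_mk.2 (by omega)), hvj⟩⟩)
    · simp only [Finset.mem_insert, Sum.inr.injEq, Finset.mem_image, reduceCtorEq, and_false,
        exists_false, or_false] at hv1 hvj
      have := congrArg Fin.val (hv1.symm.trans hvj)
      simp only at this
      omega
  obtain ⟨G, hGv, hGs, hGpos⟩ := exists_pos_sparse_decomposition B m hRIP' H' hH' (fun x hx => by
    rw [hHs, map_add, map_mul, eval_C]
    exact hK x hx)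
  have hcert (ℓ : Fin (m + 1)) : ∃ s t : MvPolynomial (Fin n ⊕ Fin (m + 1)) ℝ, IsSOSOn (A ℓ) s ∧
      t.vars ⊆ A ℓ ∧ G ℓ = s + t * c ℓ :=
    exists_isSOSOn_add_mul_sphere (by simpa only [B, Fin.is_lt, dif_pos] using hGv ℓ)
      (hGpos ℓ (Nat.lt_succ_iff.1 ℓ.is_lt))
  choose s t hs ht hst using hcert
  refine ⟨s, fun ℓ => t ℓ - C K * c ℓ, hs, fun ℓ => ?_, ?_⟩
  · rw [vars_subset_iff_mem_supported]
    exact sub_mem (vars_subset_iff_mem_supported.1 (ht ℓ))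
      (mul_mem (Subalgebra.algebraMap_mem _ K) (hcv ℓ))
  · have hF : F = ∑ ℓ : Fin (m + 1), (G ℓ - C K * c ℓ ^ 2) := by
      rw [Finset.sum_sub_distrib, Fin.sum_univ_eq_sum_range, hGs, hHs, ← Finset.mul_sum]
      ring
    refine hF.trans (Finset.sum_congr rfl fun ℓ _ => ?_)
    rw [hc, hst]
    ring
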